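/- arXiv:1501.01544 — 4 statements merged into one kernel-verified Lean document; each statement's English description precedes it below -/
import Mathlib

section
/- Let m ∈ [0,1] and δ > 0. The function φ^δ is Lipschitz continuous on ℝ with Lipschitz constant δ^{(m−1)/2}, i.e. |φ^δ(a) − φ^δ(b)| ≤ δ^{(m−1)/2}·|a − b| for all a, b ∈ ℝ. -/
/-- `φ^δ(r) = (r² + δ)^((m−1)/2)·r`. -/
noncomputable def phiDelta (m δ : ℝ) (r : ℝ) : ℝ :=
  (r ^ 2 + δ) ^ ((m - 1) / 2) * r

theorem hasDerivAt_phiDelta (m : ℝ) {δ : ℝ} (hδ : 0 < δ) (r : ℝ) :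
    HasDerivAt (phiDelta m δ) ((r ^ 2 + δ) ^ ((m - 1) / 2 - 1) * (m * r ^ 2 + δ)) r := by
  have hpos : 0 < r ^ 2 + δ := by positivity
  have hbase : HasDerivAt (fun x : ℝ => x ^ 2 + δ) (2 * r) r := by
    simpa using (hasDerivAt_pow 2 r).add_const δ
  refine ((hbase.rpow_const (p := (m - 1) / 2) (Or.inl hpos.ne')).mul
    (hasDerivAt_id r)).congr_deriv ?_
  have hsplit : (r ^ 2 + δ) ^ ((m - 1) / 2) =
      (r ^ 2 + δ) ^ ((m - 1) / 2 - 1) * (r ^ 2 + δ) := by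
    rw [← Real.rpow_add_one hpos.ne', sub_add_cancel]
  simp only [id, hsplit]
  ring

theorem abs_deriv_phiDelta_le {m δ : ℝ} (hm : m ∈ Set.Icc (0 : ℝ) 1) (hδ : 0 < δ) (r : ℝ) :
    |(r ^ 2 + δ) ^ ((m - 1) / 2 - 1) * (m * r ^ 2 + δ)| ≤ δ ^ ((m - 1) / 2) := by
  obtain ⟨hm0, hm1⟩ := hm
  have hpos : 0 < r ^ 2 + δ := by positivity
  rw [abs_of_nonneg (by positivity)]
  calc (r ^ 2 + δ) ^ ((m - 1) / 2 - 1) * (m * r ^ 2 + δ)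
      ≤ (r ^ 2 + δ) ^ ((m - 1) / 2 - 1) * (r ^ 2 + δ) := by
        gcongr
        exact mul_le_of_le_one_left (sq_nonneg r) hm1
    _ = (r ^ 2 + δ) ^ ((m - 1) / 2) := by
        rw [← Real.rpow_add_one hpos.ne', sub_add_cancel]
    _ ≤ δ ^ ((m - 1) / 2) :=
        Real.rpow_le_rpow_of_nonpos hδ (le_add_of_nonneg_left (sq_nonneg r)) (by linarith)

theorem stmt_2 (m δ : ℝ) (hm : m ∈ Set.Icc (0 : ℝ) 1) (hδ : 0 < δ) :
    ∀ a b : ℝ, |phiDelta m δ a - phiDelta m δ b| ≤ δ ^ ((m - 1) / 2) * |a - b| := by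
  intro a b
  exact convex_univ.norm_image_sub_le_of_norm_hasDerivWithin_le
    (fun r _ => (hasDerivAt_phiDelta m hδ r).hasDerivWithinAt)
    (fun r _ => abs_deriv_phiDelta_le hm hδ r) (Set.mem_univ b) (Set.mem_univ a)
end

section
/- Let m ∈ [0,1] and δ > 0. The function r ↦ (r² + δ)^{(m−3)/2}·(δ + m·r²) (the derivative of φ^δ) is Lipschitz continuous on ℝ with Lipschitz constant 5·δ^{(m−2)/2}. -/
/-- The derivative of `φ^δ`: `r ↦ (r² + δ)^((m−3)/2)·(δ + m·r²)`. -/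
noncomputable def phiDeltaDeriv (m δ : ℝ) (r : ℝ) : ℝ :=
  (r ^ 2 + δ) ^ ((m - 3) / 2) * (δ + m * r ^ 2)

theorem hasDerivAt_phiDeltaDeriv (m : ℝ) {δ : ℝ} (hδ : 0 < δ) (r : ℝ) :
    HasDerivAt (phiDeltaDeriv m δ)
      (-(1 - m) * r * (3 * δ + m * r ^ 2) * (r ^ 2 + δ) ^ ((m - 5) / 2)) r := by
  have hs : 0 < r ^ 2 + δ := by positivity
  have hsq : HasDerivAt (fun x : ℝ => x ^ 2) (2 * r) r := by simpa using hasDerivAt_pow 2 r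
  have hpow := (hsq.add_const δ).rpow_const (p := (m - 3) / 2) (Or.inl hs.ne')
  have hsplit : (r ^ 2 + δ) ^ ((m - 3) / 2) = (r ^ 2 + δ) ^ ((m - 5) / 2) * (r ^ 2 + δ) := by
    rw [← Real.rpow_add_one hs.ne']
    ring_nf
  have hexp : (m - 3) / 2 - 1 = (m - 5) / 2 := by ring
  refine (hpow.mul ((hsq.const_mul m).const_add δ)).congr_deriv ?_
  rw [hexp, hsplit]
  ring

theorem abs_deriv_phiDeltaDeriv_le {m δ : ℝ} (hm : m ∈ Set.Icc (0 : ℝ) 1) (hδ : 0 < δ) (r : ℝ) :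
    |-(1 - m) * r * (3 * δ + m * r ^ 2) * (r ^ 2 + δ) ^ ((m - 5) / 2)| ≤
      3 * δ ^ ((m - 2) / 2) := by
  obtain ⟨hm0, hm1⟩ := hm
  have hs : 0 < r ^ 2 + δ := by positivity
  have hr : |r| ≤ (r ^ 2 + δ) ^ (1 / 2 : ℝ) := by
    rw [← Real.sqrt_eq_rpow]
    exact Real.abs_le_sqrt (by linarith)
  have hm' : |-(1 - m)| ≤ 1 := by
    rw [abs_neg, abs_of_nonneg] <;> linarith
  have hq : |3 * δ + m * r ^ 2| ≤ 3 * (r ^ 2 + δ) := by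
    rw [abs_of_nonneg (by positivity)]
    nlinarith [sq_nonneg r]
  have hexp : (m - 2) / 2 = 1 / 2 + 1 + (m - 5) / 2 := by ring
  calc |-(1 - m) * r * (3 * δ + m * r ^ 2) * (r ^ 2 + δ) ^ ((m - 5) / 2)|
      = |-(1 - m)| * |r| * |3 * δ + m * r ^ 2| * (r ^ 2 + δ) ^ ((m - 5) / 2) := by
        rw [abs_mul, abs_mul, abs_mul, abs_of_pos (Real.rpow_pos_of_pos hs _)]
    _ ≤ 1 * (r ^ 2 + δ) ^ (1 / 2 : ℝ) * (3 * (r ^ 2 + δ)) * (r ^ 2 + δ) ^ ((m - 5) / 2) := by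
        gcongr
    _ = 3 * (r ^ 2 + δ) ^ ((m - 2) / 2) := by
        rw [hexp, Real.rpow_add hs, Real.rpow_add_one hs.ne']
        ring
    _ ≤ 3 * δ ^ ((m - 2) / 2) := by
        gcongr 3 * ?_
        exact Real.rpow_le_rpow_of_nonpos hδ (by nlinarith [sq_nonneg r]) (by linarith)

theorem stmt_3 (m δ : ℝ) (hm : m ∈ Set.Icc (0 : ℝ) 1) (hδ : 0 < δ) :
    ∀ a b : ℝ,
      |phiDeltaDeriv m δ a - phiDeltaDeriv m δ b| ≤ 5 * δ ^ ((m - 2) / 2) * |a - b| := by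
  intro a b
  have h := convex_univ.norm_image_sub_le_of_norm_hasDerivWithin_le
    (fun x _ => (hasDerivAt_phiDeltaDeriv m hδ x).hasDerivWithinAt)
    (fun x _ => abs_deriv_phiDeltaDeriv_le hm hδ x) (Set.mem_univ b) (Set.mem_univ a)
  refine h.trans ?_
  rw [Real.norm_eq_abs]
  gcongr
  norm_num
end

section
/- Let m ∈ [0,1] and δ ∈ (0,1]. For every r ∈ ℝ, φ^δ(r)·r ≥ (m+1)·ψ^δ(r) − 1; that is, the coercivity condition φ(r)·r ≥ c_ψ·ψ(r) − C_ψ holds for the family (ψ^δ, φ^δ) with constants c_ψ = m+1 and C_ψ = 1 independent of δ. -/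
/-- `ψ^δ(r) = ((r² + δ)^((m+1)/2) − δ^((m+1)/2))/(m+1)`. -/
noncomputable def psiDelta (m δ : ℝ) (r : ℝ) : ℝ :=
  ((r ^ 2 + δ) ^ ((m + 1) / 2) - δ ^ ((m + 1) / 2)) / (m + 1)

theorem stmt_4 (m δ : ℝ) (hm : m ∈ Set.Icc (0 : ℝ) 1) (hδ : δ ∈ Set.Ioc (0 : ℝ) 1) :
    ∀ r : ℝ, phiDelta m δ r * r ≥ (m + 1) * psiDelta m δ r - 1 := by
  intro r
  obtain ⟨hm0, hm1⟩ := hm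
  have hδ0 : 0 < δ := hδ.1
  have hs : 0 < r ^ 2 + δ := by positivity
  have rpow_split (x : ℝ) (hx : 0 < x) : x ^ ((m + 1) / 2) = x ^ ((m - 1) / 2) * x := by
    rw [← Real.rpow_add_one hx.ne']
    ring_nf
  have hle : (r ^ 2 + δ) ^ ((m - 1) / 2) ≤ δ ^ ((m - 1) / 2) :=
    Real.rpow_le_rpow_of_nonpos hδ0 (by linarith [sq_nonneg r]) (by linarith)
  have hmul := mul_le_mul_of_nonneg_right hle hδ0.le
  rw [phiDelta, psiDelta, mul_div_cancel₀ _ (by positivity), rpow_split _ hs, rpow_split _ hδ0]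
  linarith
end

section
/- Let m ∈ [0,1] and ε > 0. Then ψ(0) = ψ^ε(0), for every r ≠ 0 one has 0 ≤ ψ(r) − ψ^ε(r) ≤ ε·|r|^{2m}, and consequently ψ(r) − ψ^ε(r) ≤ ε·(1 + (m+1)·ψ(r)) for all r ∈ ℝ. -/
/-- `ψ(r) = |r|^(m+1)/(m+1)`. -/
noncomputable def psi (m : ℝ) (r : ℝ) : ℝ := |r| ^ (m + 1) / (m + 1)

/-- The Moreau–Yosida approximation `ψ^ε(r) = inf_s [(r−s)²/(2ε) + ψ(s)]`. -/
noncomputable def psiMY (m ε : ℝ) (r : ℝ) : ℝ :=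
  ⨅ s : ℝ, ((r - s) ^ 2 / (2 * ε) + psi m s)

theorem psi_nonneg {m : ℝ} (hm : 0 ≤ m) (r : ℝ) : 0 ≤ psi m r := by
  unfold psi; positivity

theorem psi_zero {m : ℝ} (hm : 0 ≤ m) : psi m 0 = 0 := by
  simp [psi, Real.zero_rpow (by linarith : m + 1 ≠ 0)]

/-- The convexity inequality for `psi m` at the point `r ≠ 0`. -/
theorem psi_sub_psi_le {m r : ℝ} (hm : 0 ≤ m) (hr : r ≠ 0) (s : ℝ) :
    psi m r - psi m s ≤ |r| ^ m * |r - s| := by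
  have ha : 0 < |r| := abs_pos.mpr hr
  have hm1 : 0 < m + 1 := by linarith
  have hq : 0 ≤ |s| / |r| := by positivity
  have bernoulli := one_add_mul_self_le_rpow_one_add (s := |s| / |r| - 1) (by linarith)
    (p := m + 1) (by linarith)
  rw [add_sub_cancel, Real.div_rpow (abs_nonneg s) ha.le, le_div_iff₀ (by positivity),
    Real.rpow_add_one ha.ne'] at bernoulli
  have hdiv : |s| / |r| * |r| = |s| := div_mul_cancel₀ _ ha.ne'
  have hexp : (1 + (m + 1) * (|s| / |r| - 1)) * (|r| ^ m * |r|)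
      = |r| ^ m * |r| - (m + 1) * (|r| ^ m * (|r| - |s|)) := by
    linear_combination (m + 1) * |r| ^ m * hdiv
  have htangent : psi m r - psi m s ≤ |r| ^ m * (|r| - |s|) := by
    unfold psi
    rw [← sub_div, div_le_iff₀ hm1, Real.rpow_add_one ha.ne']
    linarith
  exact htangent.trans
    (mul_le_mul_of_nonneg_left (abs_sub_abs_le_abs_sub r s) (by positivity))

theorem psiMY_le_psi {m ε : ℝ} (hm : 0 ≤ m) (hε : 0 < ε) (r : ℝ) :
    psiMY m ε r ≤ psi m r := by
  have hbdd : BddBelow (Set.range fun s : ℝ => (r - s) ^ 2 / (2 * ε) + psi m s) := by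
    refine ⟨0, ?_⟩
    rintro _ ⟨s, rfl⟩
    have := psi_nonneg hm s
    positivity
  simpa [psiMY] using ciInf_le hbdd r

theorem psiMY_nonneg {m ε : ℝ} (hm : 0 ≤ m) (hε : 0 < ε) (r : ℝ) : 0 ≤ psiMY m ε r := by
  refine le_ciInf fun s => ?_
  have := psi_nonneg hm s
  positivity

theorem psi_sub_psiMY_le {m ε r : ℝ} (hm : 0 ≤ m) (hε : 0 < ε) (hr : r ≠ 0) :
    psi m r - psiMY m ε r ≤ ε * |r| ^ (2 * m) := by
  have hpow : |r| ^ (2 * m) = (|r| ^ m) ^ 2 := by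
    rw [mul_comm, Real.rpow_mul (abs_nonneg r), Real.rpow_two]
  suffices h : psi m r - ε * |r| ^ (2 * m) ≤ psiMY m ε r by linarith
  refine le_ciInf fun s => ?_
  have htangent := psi_sub_psi_le hm hr s
  have hyoung : |r| ^ m * |r - s| ≤ (r - s) ^ 2 / (2 * ε) + ε * (|r| ^ m) ^ 2 := by
    rw [← sq_abs (r - s), div_add' _ _ _ (by positivity), le_div_iff₀ (by positivity)]
    nlinarith [sq_nonneg (|r - s| - ε * |r| ^ m), sq_nonneg (ε * |r| ^ m)]
  rw [hpow]
  linarith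

theorem rpow_two_mul_le_one_add_rpow {m x : ℝ} (hm : m ∈ Set.Icc (0 : ℝ) 1) (hx : 0 ≤ x) :
    x ^ (2 * m) ≤ 1 + x ^ (m + 1) := by
  obtain ⟨hm0, hm1⟩ := hm
  rcases le_total x 1 with h | h
  · have := Real.rpow_le_one hx h (by linarith : 0 ≤ 2 * m)
    have := Real.rpow_nonneg hx (m + 1)
    linarith
  · have := Real.rpow_le_rpow_of_exponent_le h (by linarith : 2 * m ≤ m + 1)
    linarith

theorem stmt_11 (m ε : ℝ) (hm : m ∈ Set.Icc (0 : ℝ) 1) (hε : 0 < ε) :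
    psi m 0 = psiMY m ε 0 ∧
    (∀ r : ℝ, r ≠ 0 →
      0 ≤ psi m r - psiMY m ε r ∧ psi m r - psiMY m ε r ≤ ε * |r| ^ (2 * m)) ∧
    (∀ r : ℝ, psi m r - psiMY m ε r ≤ ε * (1 + (m + 1) * psi m r)) := by
  have hm0 := hm.1
  have hzero : psi m 0 = psiMY m ε 0 :=
    le_antisymm ((psi_zero hm0).trans_le (psiMY_nonneg hm0 hε 0)) (psiMY_le_psi hm0 hε 0)
  refine ⟨hzero, fun r hr => ⟨sub_nonneg.mpr (psiMY_le_psi hm0 hε r),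
    psi_sub_psiMY_le hm0 hε hr⟩, fun r => ?_⟩
  rcases eq_or_ne r 0 with rfl | hr
  · rw [← hzero, sub_self]
    have := psi_nonneg hm0 0
    positivity
  · refine (psi_sub_psiMY_le hm0 hε hr).trans (mul_le_mul_of_nonneg_left ?_ hε.le)
    have hpsi : (m + 1) * psi m r = |r| ^ (m + 1) :=
      mul_div_cancel₀ _ (by linarith)
    rw [hpsi]
    exact rpow_two_mul_le_one_add_rpow hm (abs_nonneg r)
end
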